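/- In the abstract setting with A_t, B_t continuously differentiable in t (i.e. Ȧ_t and Ḃ_t exist and are continuous in t in the uniform sense), the one-sided derivatives λ̇_j^± of each eigenvalue λ_j are unilaterally continuous: lim_{h→+0} λ̇_j^+(t+h) = λ̇_j^+(t) and lim_{h→−0} λ̇_j^−(t+h) = λ̇_j^−(t) for all t and j. -/

import Mathlib

/-- The `j`-th min-max eigenvalue of the pair `(A, B)`. -/
noncomputable def minMaxEig {V : Type*} [AddCommGroup V] [Module ℝ V]
    (A B : V → V → ℝ) (j : ℕ) : ℝ :=
  sInf {μ : ℝ | ∃ L : Submodule ℝ V, Module.finrank ℝ L = j ∧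
    μ = sSup ((fun v => A v v / B v v) '' {v : V | v ∈ L ∧ v ≠ 0})}

open Filter Topology InnerProductSpace

/-- Normalized approximate eigenvectors of the pencil `(a, b)` have a subsequence converging to an
eigenvector. -/
theorem exists_subseq_tendsto_eigenvector
    {V : Type*} [NormedAddCommGroup V] [InnerProductSpace ℝ V] [CompleteSpace V]
    {X : Type*} [NormedAddCommGroup X] [InnerProductSpace ℝ X]
    {ι : V →L[ℝ] X} (hι : IsCompactOperator ι)
    (a : V →L[ℝ] V →L[ℝ] ℝ) (b : X →L[ℝ] X →L[ℝ] ℝ) {δ : ℝ} (hδ : 0 < δ)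
    (ha : ∀ v, δ * ‖v‖ ^ 2 ≤ a v v) (μ : ℝ) {u : ℕ → V} (hu : ∀ n, ‖u n‖ = 1)
    (hF : Tendsto (fun n => a (u n) - μ • b.bilinearComp ι ι (u n)) atTop (𝓝 0)) :
    ∃ v, ∃ φ : ℕ → ℕ, StrictMono φ ∧ Tendsto (u ∘ φ) atTop (𝓝 v) ∧ ‖v‖ = 1 ∧
      a v = μ • b.bilinearComp ι ι v := by
  set F : ℕ → V →L[ℝ] ℝ := fun n => a (u n) - μ • b.bilinearComp ι ι (u n) with hFdef
  obtain ⟨K, hK, hKsub⟩ := hι.image_closedBall_subset_compact (𝕜₁ := ℝ) (f := (ι : V →ₗ[ℝ] X)) 1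
  obtain ⟨x, -, φ, hφ, hx⟩ := hK.tendsto_subseq (x := fun n => ι (u n))
    fun n => hKsub ⟨u n, by simp [hu n], rfl⟩
  have hFφ : Tendsto (fun n => ‖F (φ n)‖) atTop (𝓝 0) := by
    simpa using (hF.comp hφ.tendsto_atTop).norm
  have hcauchy : CauchySeq (u ∘ φ) := by
    rw [cauchySeq_iff_tendsto_dist_atTop_0]
    have hfst : Tendsto (Prod.fst : ℕ × ℕ → ℕ) atTop atTop := tendsto_fst.mono_left (by
      rw [prod_atTop_atTop_eq])
    have hsnd : Tendsto (Prod.snd : ℕ × ℕ → ℕ) atTop atTop := tendsto_snd.mono_left (by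
      rw [prod_atTop_atTop_eq])
    have hG : Tendsto (fun p : ℕ × ℕ => √((2 * (‖F (φ p.1)‖ + ‖F (φ p.2)‖) +
        |μ| * ‖b‖ * ‖ι (u (φ p.1)) - ι (u (φ p.2))‖ ^ 2) / δ)) atTop (𝓝 0) := by
      have h := (((((hFφ.comp hfst).add (hFφ.comp hsnd)).const_mul 2).add
        ((((hx.comp hfst).sub (hx.comp hsnd)).norm.pow 2).const_mul (|μ| * ‖b‖))).div_const δ).sqrt
      simpa using h
    refine squeeze_zero (fun _ => dist_nonneg) (fun p => ?_) hG
    refine Real.le_sqrt_of_sq_le ?_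
    rw [le_div_iff₀ hδ, dist_eq_norm, Function.comp, Function.comp]
    set w := u (φ p.1) - u (φ p.2) with hw
    have hid : a w w = F (φ p.1) w - F (φ p.2) w + μ * b (ι w) (ι w) := by
      have : a w w = a (u (φ p.1)) w - a (u (φ p.2)) w := by
        rw [← sub_apply, ← map_sub]
      have hb : b (ι w) (ι w) = b (ι (u (φ p.1))) (ι w) - b (ι (u (φ p.2))) (ι w) := by
        rw [← sub_apply, ← map_sub, ← map_sub]
      simp only [hFdef, sub_apply, smul_apply,
        ContinuousLinearMap.bilinearComp_apply, smul_eq_mul]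
      rw [this, hb]
      ring
    have hw2 : ‖w‖ ≤ 2 := (norm_sub_le _ _).trans (by rw [hu, hu]; norm_num)
    have hF1 (n : ℕ) : |F n w| ≤ 2 * ‖F n‖ := by
      have := (F n).le_opNorm w
      rw [Real.norm_eq_abs] at this
      nlinarith [norm_nonneg (F n)]
    have hb : μ * b (ι w) (ι w) ≤ |μ| * ‖b‖ * ‖ι w‖ ^ 2 := by
      have h1 := b.le_opNorm₂ (ι w) (ι w)
      calc μ * b (ι w) (ι w) ≤ |μ| * |b (ι w) (ι w)| := by rw [← abs_mul]; exact le_abs_self _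
        _ ≤ |μ| * (‖b‖ * ‖ι w‖ * ‖ι w‖) := by
          gcongr
          exact h1
        _ = _ := by ring
    rw [← map_sub, ← hw]
    have h1 := ha w
    have h2 := le_abs_self (F (φ p.1) w)
    have h3 := neg_abs_le (F (φ p.2) w)
    linarith [hF1 (φ p.1), hF1 (φ p.2)]
  obtain ⟨v, hv⟩ := cauchySeq_tendsto_of_complete hcauchy
  refine ⟨v, φ, hφ, hv, ?_, ?_⟩
  · exact tendsto_nhds_unique hv.norm (by simp [hu])
  · have hlim := ((a.continuous.tendsto v).comp hv).sub
      ((((b.bilinearComp ι ι).continuous.tendsto v).comp hv).const_smul μ)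
    exact sub_eq_zero.mp (tendsto_nhds_unique hlim (hF.comp hφ.tendsto_atTop))

/-- A gradient step of size `M⁻¹` lowers the quadratic form of a symmetric operator. -/
theorem inner_gradient_step_le
    {V : Type*} [NormedAddCommGroup V] [InnerProductSpace ℝ V] (S : V →L[ℝ] V)
    (hS : ∀ x y, ⟪S x, y⟫_ℝ = ⟪x, S y⟫_ℝ) {M : ℝ} (hM : 0 < M) (hSM : ‖S‖ ≤ M) (v : V) :
    ⟪S (v - M⁻¹ • S v), v - M⁻¹ • S v⟫_ℝ ≤ ⟪S v, v⟫_ℝ - M⁻¹ * ‖S v‖ ^ 2 := by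
  have h1 : ⟪S (S v), v⟫_ℝ = ‖S v‖ ^ 2 := by rw [hS, real_inner_self_eq_norm_sq]
  have h2 : ⟪S (S v), S v⟫_ℝ ≤ M * ‖S v‖ ^ 2 := by
    calc ⟪S (S v), S v⟫_ℝ ≤ ‖S (S v)‖ * ‖S v‖ := real_inner_le_norm _ _
      _ ≤ (M * ‖S v‖) * ‖S v‖ := by gcongr; exact S.le_of_opNorm_le hSM _
      _ = _ := by ring
  have h3 : M⁻¹ * (M⁻¹ * ⟪S (S v), S v⟫_ℝ) ≤ M⁻¹ * ‖S v‖ ^ 2 := by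
    gcongr
    rw [inv_mul_le_iff₀ hM]
    exact h2
  simp only [map_sub, map_smul, inner_sub_left, inner_sub_right, real_inner_smul_left,
    real_inner_smul_right, h1, real_inner_self_eq_norm_sq]
  linarith

/-- The Rayleigh quotient is bounded above on finite-dimensional subspaces. -/
theorem bddAbove_rayleigh
    {V : Type*} [NormedAddCommGroup V] [InnerProductSpace ℝ V]
    {X : Type*} [NormedAddCommGroup X] [InnerProductSpace ℝ X]
    {ι : V →L[ℝ] X} (hinj : Function.Injective ι)
    (a : V →L[ℝ] V →L[ℝ] ℝ) (b : X →L[ℝ] X →L[ℝ] ℝ) {δ : ℝ} (hδ : 0 < δ)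
    (hb : ∀ v, δ * ‖v‖ ^ 2 ≤ b v v) (L : Submodule ℝ V) [FiniteDimensional ℝ L] :
    BddAbove ((fun v => a v v / b (ι v) (ι v)) '' {v : V | v ∈ L ∧ v ≠ 0}) := by
  have hker : LinearMap.ker ((ι : V →ₗ[ℝ] X).comp L.subtype) = ⊥ :=
    LinearMap.ker_eq_bot.mpr (hinj.comp L.injective_subtype)
  obtain ⟨K, -, hK⟩ := LinearMap.exists_antilipschitzWith _ hker
  refine ⟨‖a‖ * (K : ℝ) ^ 2 / δ, ?_⟩
  rintro _ ⟨v, ⟨hvL, hv0⟩, rfl⟩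
  have hvK : ‖v‖ ≤ K * ‖ι v‖ := by
    simpa using hK.le_mul_norm (map_zero _) (⟨v, hvL⟩ : L)
  have hιv : 0 < ‖ι v‖ := norm_pos_iff.mpr fun h => hv0 (hinj (by rw [h, map_zero]))
  have hbpos : 0 < b (ι v) (ι v) := lt_of_lt_of_le (by positivity) (hb (ι v))
  have hav : a v v ≤ ‖a‖ * ‖v‖ * ‖v‖ := (le_abs_self _).trans (a.le_opNorm₂ v v)
  simp only
  rw [div_le_div_iff₀ hbpos hδ]
  calc a v v * δ ≤ (‖a‖ * ‖v‖ * ‖v‖) * δ := by gcongr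
    _ ≤ (‖a‖ * (K * ‖ι v‖) * (K * ‖ι v‖)) * δ := by gcongr
    _ = ‖a‖ * (K : ℝ) ^ 2 * (δ * ‖ι v‖ ^ 2) := by ring
    _ ≤ _ := by gcongr; exact hb _

/-- The min-max value is attained: it is an eigenvalue of the pencil `(a, b)`. -/
theorem exists_eigenvector_minMaxEig
    {V : Type*} [NormedAddCommGroup V] [InnerProductSpace ℝ V] [CompleteSpace V]
    {X : Type*} [NormedAddCommGroup X] [InnerProductSpace ℝ X]
    {ι : V →L[ℝ] X} (hinj : Function.Injective ι) (hι : IsCompactOperator ι)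
    (a : V →L[ℝ] V →L[ℝ] ℝ) (b : X →L[ℝ] X →L[ℝ] ℝ) {δ : ℝ} (hδ : 0 < δ)
    (ha : ∀ v, δ * ‖v‖ ^ 2 ≤ a v v) (hb : ∀ v, δ * ‖v‖ ^ 2 ≤ b v v)
    (hasymm : ∀ u v, a u v = a v u) (hbsymm : ∀ u v, b u v = b v u) {j : ℕ} (hj : 1 ≤ j)
    (hL : ∃ L : Submodule ℝ V, Module.finrank ℝ L = j) :
    ∃ u : V, ‖u‖ = 1 ∧ a u =
      minMaxEig (fun u v : V => a u v) (fun u v : V => b (ι u) (ι v)) j •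
        b.bilinearComp ι ι u := by
  set μ := minMaxEig (fun u v : V => a u v) (fun u v : V => b (ι u) (ι v)) j with hμ
  set q : V →L[ℝ] V →L[ℝ] ℝ := a - μ • b.bilinearComp ι ι with hq
  have hqapp (u v : V) : q u v = a u v - μ * b (ι u) (ι v) := by
    simp [hq]
  set S : V →L[ℝ] V := continuousLinearMapOfBilin (𝕜 := ℝ) q
  have hSapp (u v : V) : ⟪S u, v⟫_ℝ = q u v := continuousLinearMapOfBilin_apply _ u v
  have hbpos {v : V} (hv : v ≠ 0) : 0 < b (ι v) (ι v) := by
    have : 0 < ‖ι v‖ := norm_pos_iff.mpr fun h => hv (hinj (by rw [h, map_zero]))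
    exact lt_of_lt_of_le (by positivity) (hb (ι v))
  by_cases hbelow : ∃ c > 0, ∀ v, c * ‖v‖ ≤ ‖S v‖
  · exfalso
    obtain ⟨c, hc, hcS⟩ := hbelow
    have hS (x y : V) : ⟪S x, y⟫_ℝ = ⟪x, S y⟫_ℝ := by
      rw [real_inner_comm (S y) x, hSapp, hSapp, hqapp, hqapp, hasymm, hbsymm]
    set M := ‖S‖ + 1
    have hM : 0 < M := by positivity
    set C := ‖b.bilinearComp ι ι‖ + 1
    have hC : 0 < C := by positivity
    have hbC (v : V) : b (ι v) (ι v) ≤ C * ‖v‖ ^ 2 := by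
      have := (le_abs_self _).trans ((b.bilinearComp ι ι).le_opNorm₂ v v)
      rw [ContinuousLinearMap.bilinearComp_apply] at this
      nlinarith [sq_nonneg ‖v‖]
    set T := {x : ℝ | ∃ L : Submodule ℝ V, Module.finrank ℝ L = j ∧
      x = sSup ((fun v => a v v / b (ι v) (ι v)) '' {v : V | v ∈ L ∧ v ≠ 0})} with hT
    have hμT : μ = sInf T := rfl
    have hTbdd : BddBelow T := by
      refine ⟨0, ?_⟩
      rintro _ ⟨L, -, rfl⟩
      refine Real.sSup_nonneg ?_
      rintro _ ⟨v, ⟨-, hv⟩, rfl⟩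
      exact div_nonneg (le_trans (by positivity) (ha v)) (hbpos hv).le
    have hTne : T.Nonempty := by
      obtain ⟨L, hL⟩ := hL
      exact ⟨_, L, hL, rfl⟩
    set ε := M⁻¹ * c ^ 2 / (2 * C) with hε
    have hεpos : 0 < ε := by positivity
    have hεC : ε * C = M⁻¹ * c ^ 2 / 2 := by rw [hε]; field_simp
    obtain ⟨_, ⟨L, hLj, rfl⟩, hLlt⟩ := exists_lt_of_csInf_lt hTne (lt_add_of_pos_right (sInf T) hεpos)
    rw [← hμT] at hLlt
    have : FiniteDimensional ℝ L := Module.finite_of_finrank_pos (by omega)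
    set P : V →ₗ[ℝ] V := ((ContinuousLinearMap.id ℝ V - M⁻¹ • S : V →L[ℝ] V) : V →ₗ[ℝ] V)
    have hP (v : V) : P v = v - M⁻¹ • S v := rfl
    have hQL (v : V) (hv : v ∈ L) : q v v ≤ ε * C * ‖v‖ ^ 2 := by
      rcases eq_or_ne v 0 with rfl | hv0
      · simp
      have h1 : a v v / b (ι v) (ι v) ≤ μ + ε :=
        (le_csSup (bddAbove_rayleigh hinj a b hδ hb L) ⟨v, ⟨hv, hv0⟩, rfl⟩).trans hLlt.le
      rw [div_le_iff₀ (hbpos hv0)] at h1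
      rw [hqapp]
      nlinarith [hbC v]
    have hQP (v : V) (hv : v ∈ L) : q (P v) (P v) ≤ -(ε * C) * ‖v‖ ^ 2 := by
      have h1 := inner_gradient_step_le S hS hM (by simp [M]) v
      rw [hSapp, hSapp, ← hP] at h1
      have h2 : M⁻¹ * (c * ‖v‖) ^ 2 ≤ M⁻¹ * ‖S v‖ ^ 2 := by
        gcongr
        exact hcS v
      nlinarith [hQL v hv]
    have hPnorm (v : V) : ‖P v‖ ≤ 2 * ‖v‖ := by
      have h1 : ‖M⁻¹ • S v‖ ≤ ‖v‖ := by
        rw [norm_smul, Real.norm_of_nonneg (by positivity), inv_mul_le_iff₀ hM]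
        exact S.le_of_opNorm_le (by simp [M]) v
      rw [hP]
      linarith [norm_sub_le v (M⁻¹ • S v)]
    have hinjP : Function.Injective (P.domRestrict L) := by
      rw [← LinearMap.ker_eq_bot, LinearMap.ker_eq_bot']
      rintro ⟨v, hv⟩ h
      have h0 : P v = 0 := h
      have h1 := hQP v hv
      rw [h0] at h1
      simp only [map_zero] at h1
      have h2 : ‖v‖ = 0 := by
        by_contra hne
        have : 0 < ‖v‖ ^ 2 := by positivity
        nlinarith [mul_pos (mul_pos hεpos hC) this]
      simpa using h2
    have hfin : Module.finrank ℝ (L.map P) = j := by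
      rw [← hLj, ← LinearMap.range_domRestrict]
      exact LinearMap.finrank_range_of_inj hinjP
    have hnew : μ ≤ sSup ((fun v => a v v / b (ι v) (ι v)) '' {v : V | v ∈ L.map P ∧ v ≠ 0}) :=
      csInf_le hTbdd ⟨_, hfin, rfl⟩
    have hle : sSup ((fun v => a v v / b (ι v) (ι v)) '' {v : V | v ∈ L.map P ∧ v ≠ 0}) ≤
        μ - ε / 4 := by
      refine csSup_le ?_ ?_
      · have hne : L.map P ≠ ⊥ := by
          intro h
          rw [h, finrank_bot] at hfin
          omega
        obtain ⟨w, hw, hw0⟩ := (Submodule.ne_bot_iff _).mp hne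
        exact ⟨_, w, ⟨hw, hw0⟩, rfl⟩
      · rintro _ ⟨_, ⟨⟨v, hv, rfl⟩, hw0⟩, rfl⟩
        simp only
        rw [div_le_iff₀ (hbpos hw0)]
        have h1 := hQP v hv
        rw [hqapp] at h1
        have h2 : ‖P v‖ ^ 2 ≤ 4 * ‖v‖ ^ 2 := by
          have := pow_le_pow_left₀ (norm_nonneg _) (hPnorm v) 2
          linarith [mul_pow 2 ‖v‖ 2]
        have h3 : ε * b (ι (P v)) (ι (P v)) ≤ ε * (C * (4 * ‖v‖ ^ 2)) := by
          gcongr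
          exact (hbC _).trans (by gcongr)
        linarith
    linarith
  · push Not at hbelow
    have hex (n : ℕ) : ∃ u : V, ‖u‖ = 1 ∧ ‖S u‖ ≤ 1 / ((n : ℝ) + 1) := by
      obtain ⟨v, hv⟩ := hbelow (1 / ((n : ℝ) + 1)) (by positivity)
      have hv0 : 0 < ‖v‖ := by
        by_contra h
        have : v = 0 := by simpa using h
        simp [this] at hv
      refine ⟨‖v‖⁻¹ • v, by rw [norm_smul, norm_inv, norm_norm, inv_mul_cancel₀ hv0.ne'], ?_⟩
      rw [map_smul, norm_smul, norm_inv, norm_norm, inv_mul_le_iff₀ hv0]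
      linarith
    choose u hu hSu using hex
    have hF : Tendsto (fun n => a (u n) - μ • b.bilinearComp ι ι (u n)) atTop (𝓝 0) := by
      refine squeeze_zero_norm (fun n => ?_) tendsto_one_div_add_atTop_nhds_zero_nat
      refine ContinuousLinearMap.opNorm_le_bound _ (by positivity) fun w => ?_
      have : (a (u n) - μ • b.bilinearComp ι ι (u n)) w = ⟪S (u n), w⟫_ℝ := by
        rw [hSapp, hq]
        rfl
      rw [this]
      exact (norm_inner_le_norm _ _).trans (by gcongr; exact hSu n)
    obtain ⟨v, -, -, -, hv, hav⟩ := exists_subseq_tendsto_eigenvector hι a b hδ ha μ hu hF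
    exact ⟨v, hv, hav⟩

/-- Convergence of bilinear forms, uniformly on bounded sets. -/
def BilinTendsto {α E : Type*} [NormedAddCommGroup E] (c : α → E → E → ℝ) (F : Filter α)
    (c₀ : E → E → ℝ) : Prop :=
  ∀ ε > (0 : ℝ), ∀ᶠ n in F, ∀ u v : E, |c n u v - c₀ u v| ≤ ε * ‖u‖ * ‖v‖

theorem BilinTendsto.comp {α β E : Type*} [NormedAddCommGroup E] {c : α → E → E → ℝ}
    {F : Filter α} {G : Filter β} {c₀ : E → E → ℝ} (hc : BilinTendsto c F c₀) {g : β → α}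
    (hg : Tendsto g G F) : BilinTendsto (fun n => c (g n)) G c₀ :=
  fun ε hε => hg.eventually (hc ε hε)

theorem BilinTendsto.neg {α E : Type*} [NormedAddCommGroup E] {c : α → E → E → ℝ}
    {F : Filter α} {c₀ : E → E → ℝ} (hc : BilinTendsto c F c₀) :
    BilinTendsto (fun n u v => -c n u v) F (fun u v => -c₀ u v) := by
  intro ε hε
  filter_upwards [hc ε hε] with n hn u v
  rw [neg_sub_neg, abs_sub_comm]
  exact hn u v

theorem BilinTendsto.tendsto_apply {α E : Type*} [NormedAddCommGroup E] [NormedSpace ℝ E]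
    {c : α → E → E → ℝ} {F : Filter α} {c₀ : E →L[ℝ] E →L[ℝ] ℝ}
    (hc : BilinTendsto c F (fun u v => c₀ u v)) {x y : α → E} {x₀ y₀ : E}
    (hx : Tendsto x F (𝓝 x₀)) (hy : Tendsto y F (𝓝 y₀)) :
    Tendsto (fun n => c n (x n) (y n)) F (𝓝 (c₀ x₀ y₀)) := by
  have h1 : Tendsto (fun n => c n (x n) (y n) - c₀ (x n) (y n)) F (𝓝 0) := by
    refine NormedAddGroup.tendsto_nhds_zero.mpr fun ε hε => ?_
    have hxy : ∀ᶠ n in F, ‖x n‖ * ‖y n‖ < ‖x₀‖ * ‖y₀‖ + 1 :=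
      (hx.norm.mul hy.norm).eventually_lt_const (lt_add_one _)
    filter_upwards [hc (ε / (‖x₀‖ * ‖y₀‖ + 1)) (by positivity), hxy] with n hn hn'
    calc _ ≤ ε / (‖x₀‖ * ‖y₀‖ + 1) * (‖x n‖ * ‖y n‖) := (hn _ _).trans_eq (by ring)
      _ < ε / (‖x₀‖ * ‖y₀‖ + 1) * (‖x₀‖ * ‖y₀‖ + 1) := by gcongr
      _ = ε := by field_simp
  have h2 : Tendsto (fun n => c₀ (x n) (y n)) F (𝓝 (c₀ x₀ y₀)) :=
    (c₀.isBoundedBilinearMap.continuous.tendsto (x₀, y₀)).comp (hx.prodMk_nhds hy)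
  simpa using h1.add h2

theorem BilinTendsto.mul {α E : Type*} [NormedAddCommGroup E] [NormedSpace ℝ E]
    {c : α → E → E → ℝ} {F : Filter α} {c₀ : E →L[ℝ] E →L[ℝ] ℝ}
    (hc : BilinTendsto c F (fun u v => c₀ u v)) {l : α → ℝ} {l₀ : ℝ} (hl : Tendsto l F (𝓝 l₀)) :
    BilinTendsto (fun n u v => l n * c n u v) F (fun u v => l₀ * c₀ u v) := by
  intro ε hε
  have h1 : ∀ᶠ n in F, |l n - l₀| * ‖c₀‖ < ε / 2 := by
    have h : Tendsto (fun n => |l n - l₀| * ‖c₀‖) F (𝓝 0) := by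
      simpa using (hl.sub_const l₀).abs.mul_const ‖c₀‖
    exact h.eventually_lt_const (half_pos hε)
  have h2 : ∀ᶠ n in F, |l n| < |l₀| + 1 := hl.abs.eventually_lt_const (lt_add_one _)
  filter_upwards [h1, h2, hc (ε / 2 / (|l₀| + 1)) (by positivity)] with n hn1 hn2 hn u v
  have hc₀ : |c₀ u v| ≤ ‖c₀‖ * ‖u‖ * ‖v‖ := c₀.le_opNorm₂ u v
  calc |l n * c n u v - l₀ * c₀ u v|
      = |l n * (c n u v - c₀ u v) + (l n - l₀) * c₀ u v| := by congr 1; ring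
    _ ≤ |l n| * |c n u v - c₀ u v| + |l n - l₀| * |c₀ u v| := by
      rw [← abs_mul, ← abs_mul]
      exact abs_add_le _ _
    _ ≤ (|l₀| + 1) * (ε / 2 / (|l₀| + 1) * ‖u‖ * ‖v‖) + |l n - l₀| * (‖c₀‖ * ‖u‖ * ‖v‖) := by
      gcongr
      exact hn u v
    _ = (ε / 2 + |l n - l₀| * ‖c₀‖) * ‖u‖ * ‖v‖ := by field_simp
    _ ≤ (ε / 2 + ε / 2) * ‖u‖ * ‖v‖ := by gcongr
    _ = ε * ‖u‖ * ‖v‖ := by ring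

/-- Differentiable families of forms are continuous. -/
theorem BilinTendsto.of_slope {E : Type*} [NormedAddCommGroup E] [NormedSpace ℝ E]
    {a : ℝ → E → E → ℝ} {t : ℝ} {a' : E →L[ℝ] E →L[ℝ] ℝ}
    (ha : BilinTendsto (fun h u v => (a (t + h) u v - a t u v) / h) (𝓝[≠] 0)
      (fun u v => a' u v)) :
    BilinTendsto (fun h => a (t + h)) (𝓝[≠] 0) (a t) := by
  have hid : Tendsto (fun h : ℝ => h) (𝓝[≠] 0) (𝓝 0) := tendsto_id.mono_left nhdsWithin_le_nhds
  intro ε hε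
  filter_upwards [ha.mul hid ε hε, self_mem_nhdsWithin] with h hh h0 u v
  have h0' : h ≠ 0 := h0
  have := hh u v
  rwa [mul_div_cancel₀ _ h0', zero_mul, sub_zero] at this

/-- Uniform convergence on unit balls gives uniform convergence on bounded sets. -/
theorem BilinTendsto.of_unit_ball {α E : Type*} [NormedAddCommGroup E] [NormedSpace ℝ E]
    {c : α → E →ₗ[ℝ] E →ₗ[ℝ] ℝ} {F : Filter α} {c₀ : E →ₗ[ℝ] E →ₗ[ℝ] ℝ}
    (H : ∀ ε > (0 : ℝ), ∀ᶠ n in F, ∀ u v : E, ‖u‖ ≤ 1 → ‖v‖ ≤ 1 → |c n u v - c₀ u v| ≤ ε) :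
    BilinTendsto (fun n u v => c n u v) F (fun u v => c₀ u v) := by
  intro ε hε
  filter_upwards [H ε hε] with n hn u v
  rcases eq_or_ne u 0 with rfl | hu
  · simp
  rcases eq_or_ne v 0 with rfl | hv
  · simp
  have hu' : 0 < ‖u‖ := norm_pos_iff.mpr hu
  have hv' : 0 < ‖v‖ := norm_pos_iff.mpr hv
  have h1 := hn (‖u‖⁻¹ • u) (‖v‖⁻¹ • v)
    (by rw [norm_smul, norm_inv, norm_norm, inv_mul_cancel₀ hu'.ne'])
    (by rw [norm_smul, norm_inv, norm_norm, inv_mul_cancel₀ hv'.ne'])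
  simp only [map_smul, LinearMap.smul_apply, smul_eq_mul] at h1
  rw [← mul_sub, ← mul_sub, abs_mul, abs_mul, abs_of_pos (inv_pos.mpr hu'),
    abs_of_pos (inv_pos.mpr hv'), inv_mul_le_iff₀ hv', inv_mul_le_iff₀ hu'] at h1
  linarith

/-- A first-order Taylor condition on unit balls gives convergence of the difference quotients. -/
theorem BilinTendsto.of_taylor {E : Type*} [NormedAddCommGroup E] [NormedSpace ℝ E]
    {a : ℝ → E →ₗ[ℝ] E →ₗ[ℝ] ℝ} {a' : E →ₗ[ℝ] E →ₗ[ℝ] ℝ} {t : ℝ}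
    (H : ∀ ε > (0:ℝ), ∃ η > (0:ℝ), ∀ h : ℝ, h ≠ 0 → |h| < η →
      ∀ u v : E, ‖u‖ ≤ 1 → ‖v‖ ≤ 1 → |a (t + h) u v - a t u v - h * a' u v| ≤ ε * |h|) :
    BilinTendsto (fun h u v => (a (t + h) u v - a t u v) / h) (𝓝[≠] 0) (fun u v => a' u v) := by
  have hmain : BilinTendsto (fun h u v => (h⁻¹ • (a (t + h) - a t)) u v) (𝓝[≠] 0)
      (fun u v => a' u v) := by
    refine BilinTendsto.of_unit_ball fun ε hε => ?_
    obtain ⟨η, hη, hH⟩ := H ε hε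
    filter_upwards [nhdsWithin_le_nhds (Metric.ball_mem_nhds (0 : ℝ) hη), self_mem_nhdsWithin]
      with h hh h0 u v hu hv
    have h0' : h ≠ 0 := h0
    have h1 := hH h h0' (by simpa using hh) u v hu hv
    have h2 : (h⁻¹ • (a (t + h) - a t)) u v - a' u v =
        (a (t + h) u v - a t u v - h * a' u v) / h := by
      simp only [LinearMap.smul_apply, LinearMap.sub_apply, smul_eq_mul]
      field_simp
    rwa [h2, abs_div, div_le_iff₀ (abs_pos.mpr h0')]
  intro ε hε
  filter_upwards [hmain ε hε] with h hh u v
  have := hh u v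
  simp only [LinearMap.smul_apply, LinearMap.sub_apply, smul_eq_mul] at this
  rwa [div_eq_inv_mul]

/-- Normalized eigenvectors along a sequence of parameters tending to `t` subconverge to an
eigenvector at `t` realizing the derivative of the eigenvalue along the sequence. -/
theorem exists_subseq_tendsto_eigenvector_of_slope
    {V : Type*} [NormedAddCommGroup V] [InnerProductSpace ℝ V] [CompleteSpace V]
    {X : Type*} [NormedAddCommGroup X] [InnerProductSpace ℝ X]
    {ι : V →L[ℝ] X} (hι : IsCompactOperator ι)
    {a : ℝ → V →L[ℝ] V →L[ℝ] ℝ} {b : ℝ → X →L[ℝ] X →L[ℝ] ℝ} {t δ : ℝ} (hδ : 0 < δ)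
    (ha : ∀ v, δ * ‖v‖ ^ 2 ≤ a t v v)
    (hasymm : ∀ u v, a t u v = a t v u) (hbsymm : ∀ u v, b t u v = b t v u)
    {a' : V →L[ℝ] V →L[ℝ] ℝ} {b' : X →L[ℝ] X →L[ℝ] ℝ}
    (ha' : BilinTendsto (fun h u v => (a (t + h) u v - a t u v) / h) (𝓝[≠] 0)
      (fun u v => a' u v))
    (hb' : BilinTendsto (fun h u v => (b (t + h) u v - b t u v) / h) (𝓝[≠] 0)
      (fun u v => b' u v))
    {l : ℝ → ℝ} {d : ℝ} {h : ℕ → ℝ} (hh : Tendsto h atTop (𝓝[≠] 0))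
    (hl : Tendsto (fun n => (l (t + h n) - l t) / h n) atTop (𝓝 d))
    {u : ℕ → V} (hu : ∀ n, ‖u n‖ = 1)
    (heig : ∀ n, a (t + h n) (u n) = l (t + h n) • (b (t + h n)).bilinearComp ι ι (u n)) :
    ∃ v, ∃ φ : ℕ → ℕ, StrictMono φ ∧ Tendsto (u ∘ φ) atTop (𝓝 v) ∧ ‖v‖ = 1 ∧
      a t v = l t • (b t).bilinearComp ι ι v ∧
      a' v v - l t * b' (ι v) (ι v) = d * b t (ι v) (ι v) := by
  have hh0 : Tendsto h atTop (𝓝 0) := hh.mono_right nhdsWithin_le_nhds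
  have hne : ∀ᶠ n in atTop, h n ≠ 0 := hh.eventually self_mem_nhdsWithin
  have hl0 : Tendsto (fun n => l (t + h n)) atTop (𝓝 (l t)) := by
    have := (hl.mul hh0).add_const (l t)
    rw [mul_zero, zero_add] at this
    refine this.congr' ?_
    filter_upwards [hne] with n hn
    field_simp
    ring
  have hF : Tendsto (fun n => a t (u n) - l t • (b t).bilinearComp ι ι (u n)) atTop (𝓝 0) := by
    have ha0 : BilinTendsto (fun n u v => a (t + h n) u v) atTop (fun u v => a t u v) :=
      (BilinTendsto.of_slope (a := fun s u v => a s u v) ha').comp hh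
    have hb0 : BilinTendsto (fun n u v => b (t + h n) u v) atTop (fun u v => b t u v) :=
      (BilinTendsto.of_slope (a := fun s u v => b s u v) hb').comp hh
    refine NormedAddGroup.tendsto_nhds_zero.mpr fun ε hε => ?_
    have hρ : 0 < ε / 2 / (1 + ‖ι‖ ^ 2) := by positivity
    filter_upwards [ha0 _ hρ, (hb0.mul hl0) _ hρ] with n hna hnb
    refine lt_of_le_of_lt ?_ (half_lt_self hε)
    refine ContinuousLinearMap.opNorm_le_bound _ (by positivity) fun w => ?_
    have hw : (a t (u n) - l t • (b t).bilinearComp ι ι (u n)) w =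
        (l (t + h n) * b (t + h n) (ι (u n)) (ι w) - l t * b t (ι (u n)) (ι w))
          - (a (t + h n) (u n) w - a t (u n) w) := by
      have := congrArg (fun f : V →L[ℝ] ℝ => f w) (heig n)
      simp only [sub_apply, smul_apply, ContinuousLinearMap.bilinearComp_apply,
        smul_eq_mul] at this ⊢
      rw [this]
      ring
    rw [hw, Real.norm_eq_abs]
    have h1 := hna (u n) w
    have h2 := hnb (ι (u n)) (ι w)
    have h3 := ι.le_opNorm (u n)
    rw [hu, mul_one] at h1 h3
    calc _ ≤ _ := abs_sub _ _
      _ ≤ ε / 2 / (1 + ‖ι‖ ^ 2) * ‖ι‖ * (‖ι‖ * ‖w‖) + ε / 2 / (1 + ‖ι‖ ^ 2) * ‖w‖ := by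
        refine add_le_add (h2.trans ?_) h1
        gcongr
        exact ι.le_opNorm w
      _ = ε / 2 * ‖w‖ := by
        field_simp
        ring
  obtain ⟨v, φ, hφ, hv, hv1, hav⟩ :=
    exists_subseq_tendsto_eigenvector hι (a t) (b t) hδ ha (l t) hu hF
  refine ⟨v, φ, hφ, hv, hv1, hav, ?_⟩
  have hφt := hφ.tendsto_atTop
  have hιv : Tendsto (fun n => ι (u (φ n))) atTop (𝓝 (ι v)) := (ι.continuous.tendsto v).comp hv
  have hlim := (((ha'.comp (hh.comp hφt)).tendsto_apply hv (tendsto_const_nhds (x := v))).sub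
    ((hl0.comp hφt).mul ((hb'.comp (hh.comp hφt)).tendsto_apply hιv
      (tendsto_const_nhds (x := ι v))))).sub
    ((hl.comp hφt).mul ((b t).isBoundedBilinearMap.continuous.tendsto (ι v, ι v) |>.comp
      (hιv.prodMk_nhds tendsto_const_nhds)))
  refine sub_eq_zero.mp (tendsto_nhds_unique hlim (tendsto_const_nhds.congr fun n => ?_))
  have h1 := congrArg (fun f : V →L[ℝ] ℝ => f v) (heig (φ n))
  have h2 := congrArg (fun f : V →L[ℝ] ℝ => f (u (φ n))) hav
  simp only [smul_apply, ContinuousLinearMap.bilinearComp_apply, smul_eq_mul,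
    Function.comp] at h1 h2 ⊢
  rw [hasymm, hbsymm] at h2
  rw [h1, h2]
  ring

/-- The right derivative of a right differentiable eigenvalue branch is right continuous. -/
theorem tendsto_rightDeriv_eigenvalue
    {V : Type*} [NormedAddCommGroup V] [InnerProductSpace ℝ V] [CompleteSpace V]
    {X : Type*} [NormedAddCommGroup X] [InnerProductSpace ℝ X]
    {ι : V →L[ℝ] X} (hinj : Function.Injective ι) (hι : IsCompactOperator ι)
    {a a' : ℝ → V →L[ℝ] V →L[ℝ] ℝ} {b b' : ℝ → X →L[ℝ] X →L[ℝ] ℝ} {δ : ℝ} (hδ : 0 < δ)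
    (ha : ∀ t v, δ * ‖v‖ ^ 2 ≤ a t v v) (hb : ∀ t v, δ * ‖v‖ ^ 2 ≤ b t v v)
    (hasymm : ∀ t u v, a t u v = a t v u) (hbsymm : ∀ t u v, b t u v = b t v u)
    (ha' : ∀ t, BilinTendsto (fun h u v => (a (t + h) u v - a t u v) / h) (𝓝[≠] 0)
      (fun u v => a' t u v))
    (hb' : ∀ t, BilinTendsto (fun h u v => (b (t + h) u v - b t u v) / h) (𝓝[≠] 0)
      (fun u v => b' t u v))
    (ha'cont : ∀ t, BilinTendsto (fun h u v => a' (t + h) u v) (𝓝 0) (fun u v => a' t u v))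
    (hb'cont : ∀ t, BilinTendsto (fun h u v => b' (t + h) u v) (𝓝 0) (fun u v => b' t u v))
    {l d : ℝ → ℝ}
    (hl : ∀ t, ∃ u : V, ‖u‖ = 1 ∧ a t u = l t • (b t).bilinearComp ι ι u)
    (hd : ∀ t, Tendsto (fun h => (l (t + h) - l t) / h) (𝓝[>] 0) (𝓝 (d t))) (t : ℝ) :
    Tendsto (fun h => d (t + h)) (𝓝[>] 0) (𝓝 (d t)) := by
  have hbpos (s : ℝ) {v : V} (hv : ‖v‖ = 1) : b s (ι v) (ι v) ≠ 0 := by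
    have hv0 : v ≠ 0 := by
      rintro rfl
      simp at hv
    have : 0 < ‖ι v‖ := norm_pos_iff.mpr fun h => hv0 (hinj (by rw [h, map_zero]))
    exact (lt_of_lt_of_le (by positivity) (hb s (ι v))).ne'
  have hgt : 𝓝[>] (0 : ℝ) ≤ 𝓝[≠] 0 := nhdsWithin_mono _ fun x hx => ne_of_gt hx
  have hsub (s : ℝ) {h : ℕ → ℝ} (hh : Tendsto h atTop (𝓝[>] 0)) {u : ℕ → V}
      (hu : ∀ n, ‖u n‖ = 1)
      (heig : ∀ n, a (s + h n) (u n) = l (s + h n) • (b (s + h n)).bilinearComp ι ι (u n)) :=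
    exists_subseq_tendsto_eigenvector_of_slope hι hδ (ha s) (hasymm s) (hbsymm s) (ha' s)
      (hb' s) (hh.mono_right hgt) ((hd s).comp hh) hu heig
  choose e he1 heig using hl
  have hrep (s : ℝ) : ∃ v : V, ‖v‖ = 1 ∧ a s v = l s • (b s).bilinearComp ι ι v ∧
      a' s v v - l s * b' s (ι v) (ι v) = d s * b s (ι v) (ι v) := by
    have hh : Tendsto (fun n : ℕ => 1 / ((n : ℝ) + 1)) atTop (𝓝[>] 0) :=
      tendsto_nhdsWithin_iff.mpr ⟨tendsto_one_div_add_atTop_nhds_zero_nat,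
        Eventually.of_forall fun n => by simp only [Set.mem_Ioi]; positivity⟩
    obtain ⟨v, -, -, -, hv⟩ := hsub s hh (u := fun n => e (s + 1 / ((n : ℝ) + 1)))
      (fun n => he1 _) (fun n => heig _)
    exact ⟨v, hv⟩
  choose w hw1 hweig hwd using hrep
  have hdeq (s : ℝ) : d s = (a' s (w s) (w s) - l s * b' s (ι (w s)) (ι (w s))) /
      b s (ι (w s)) (ι (w s)) := by
    rw [hwd, mul_div_cancel_right₀ _ (hbpos s (hw1 s))]
  refine tendsto_of_subseq_tendsto fun h hh => ?_
  obtain ⟨v, φ, hφ, hv, hv1, -, hvd⟩ := hsub t hh (u := fun n => w (t + h n)) (fun n => hw1 _)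
    (fun n => hweig _)
  refine ⟨φ, ?_⟩
  have hhφ := hh.comp hφ.tendsto_atTop
  have hl0 : Tendsto (fun n => l (t + h (φ n))) atTop (𝓝 (l t)) := by
    have := (((hd t).comp hhφ).mul (hhφ.mono_right nhdsWithin_le_nhds)).add_const (l t)
    rw [mul_zero, zero_add] at this
    refine this.congr' ?_
    filter_upwards [hhφ.eventually (hgt self_mem_nhdsWithin)] with n hn
    have : h (φ n) ≠ 0 := hn
    simp only [Function.comp]
    field_simp
    ring
  have hιv := (ι.continuous.tendsto v).comp hv
  have hb0 : BilinTendsto (fun n u v => b (t + h (φ n)) u v) atTop (fun u v => b t u v) :=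
    (BilinTendsto.of_slope (a := fun s u v => b s u v) (hb' t)).comp (hhφ.mono_right hgt)
  have hhφ0 := hhφ.mono_right nhdsWithin_le_nhds
  have hlim := ((((ha'cont t).comp hhφ0).tendsto_apply hv hv).sub
    (hl0.mul (((hb'cont t).comp hhφ0).tendsto_apply hιv hιv))).div
    (hb0.tendsto_apply hιv hιv) (hbpos t hv1)
  rw [hvd, mul_div_cancel_right₀ _ (hbpos t hv1)] at hlim
  exact hlim.congr fun n => (hdeq _).symm

/-- if `A_t`, `B_t` are continuously differentiable in `t` (uniform sense),
the one-sided derivatives of each eigenvalue are unilaterally continuous: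
`lim_{h→+0} λ̇_j⁺(t+h) = λ̇_j⁺(t)` and `lim_{h→−0} λ̇_j⁻(t+h) = λ̇_j⁻(t)`. -/
theorem hadamard_stmt9
    {V : Type*} [NormedAddCommGroup V] [InnerProductSpace ℝ V] [CompleteSpace V]
    {X : Type*} [NormedAddCommGroup X] [InnerProductSpace ℝ X] [CompleteSpace X]
    (ι : V →L[ℝ] X) (hι : Function.Injective ι) (hcompact : IsCompactOperator ι)
    (A : ℝ → V →ₗ[ℝ] V →ₗ[ℝ] ℝ) (B : ℝ → X →ₗ[ℝ] X →ₗ[ℝ] ℝ)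
    (hAsymm : ∀ t, ∀ u v : V, A t u v = A t v u)
    (hBsymm : ∀ t, ∀ u v : X, B t u v = B t v u)
    (CA : ℝ) (hAbdd : ∀ t, ∀ u v : V, |A t u v| ≤ CA * ‖u‖ * ‖v‖)
    (CB : ℝ) (hBbdd : ∀ t, ∀ u v : X, |B t u v| ≤ CB * ‖u‖ * ‖v‖)
    (δ : ℝ) (hδ : 0 < δ)
    (hAcoer : ∀ t, ∀ v : V, δ * ‖v‖ ^ 2 ≤ A t v v)
    (hBcoer : ∀ t, ∀ v : X, δ * ‖v‖ ^ 2 ≤ B t v v)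
    (lam : ℕ → ℝ → ℝ)
    (hlamdef : ∀ j t, lam j t =
      minMaxEig (fun u v : V => A t u v) (fun u v : V => B t (ι u) (ι v)) j)
    -- derivatives `Ȧ_t`, `Ḃ_t` for every `t`, bounded and satisfying the
    -- first-order Taylor condition uniformly on unit balls
    (A' : ℝ → V →ₗ[ℝ] V →ₗ[ℝ] ℝ) (B' : ℝ → X →ₗ[ℝ] X →ₗ[ℝ] ℝ)
    (CA' : ℝ) (hA'bdd : ∀ t, ∀ u v : V, |A' t u v| ≤ CA' * ‖u‖ * ‖v‖)
    (CB' : ℝ) (hB'bdd : ∀ t, ∀ u v : X, |B' t u v| ≤ CB' * ‖u‖ * ‖v‖)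
    (hAder : ∀ t, ∀ ε > (0:ℝ), ∃ η > (0:ℝ), ∀ h : ℝ, h ≠ 0 → |h| < η →
      ∀ u v : V, ‖u‖ ≤ 1 → ‖v‖ ≤ 1 →
        |A (t + h) u v - A t u v - h * A' t u v| ≤ ε * |h|)
    (hBder : ∀ t, ∀ ε > (0:ℝ), ∃ η > (0:ℝ), ∀ h : ℝ, h ≠ 0 → |h| < η →
      ∀ u v : X, ‖u‖ ≤ 1 → ‖v‖ ≤ 1 →
        |B (t + h) u v - B t u v - h * B' t u v| ≤ ε * |h|)
    -- `Ȧ_t`, `Ḃ_t` continuous in `t` in the uniform (operator norm) sense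
    (hA'cont : ∀ t, ∀ ε > (0:ℝ), ∃ η > (0:ℝ), ∀ h : ℝ, |h| < η →
      ∀ u v : V, ‖u‖ ≤ 1 → ‖v‖ ≤ 1 → |A' (t + h) u v - A' t u v| ≤ ε)
    (hB'cont : ∀ t, ∀ ε > (0:ℝ), ∃ η > (0:ℝ), ∀ h : ℝ, |h| < η →
      ∀ u v : X, ‖u‖ ≤ 1 → ‖v‖ ≤ 1 → |B' (t + h) u v - B' t u v| ≤ ε)
    -- `dp j t`, `dm j t` : the one-sided derivatives `λ̇_j⁺(t)`, `λ̇_j⁻(t)`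
    (dp dm : ℕ → ℝ → ℝ)
    (hdp : ∀ j t, 1 ≤ j → Filter.Tendsto (fun h : ℝ => (lam j (t + h) - lam j t) / h)
      (nhdsWithin 0 (Set.Ioi 0)) (nhds (dp j t)))
    (hdm : ∀ j t, 1 ≤ j → Filter.Tendsto (fun h : ℝ => (lam j (t + h) - lam j t) / h)
      (nhdsWithin 0 (Set.Iio 0)) (nhds (dm j t))) :
    ∀ j t, 1 ≤ j →
      Filter.Tendsto (fun h : ℝ => dp j (t + h)) (nhdsWithin 0 (Set.Ioi 0))
        (nhds (dp j t)) ∧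
      Filter.Tendsto (fun h : ℝ => dm j (t + h)) (nhdsWithin 0 (Set.Iio 0))
        (nhds (dm j t)) := by
  intro j t hj
  by_cases hL : ∃ L : Submodule ℝ V, Module.finrank ℝ L = j
  swap
  · have hlam (s : ℝ) : lam j s = 0 := by
      rw [hlamdef, minMaxEig]
      convert Real.sInf_empty
      ext x
      simp only [Set.mem_ofPred_eq, Set.mem_empty_iff_false, iff_false]
      rintro ⟨L, hLj, -⟩
      exact hL ⟨L, hLj⟩
    have hp (s : ℝ) : dp j s = 0 :=
      tendsto_nhds_unique (hdp j s hj) (by simp [hlam])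
    have hm (s : ℝ) : dm j s = 0 :=
      tendsto_nhds_unique (hdm j s hj) (by simp [hlam])
    simp [hp, hm]
  set a : ℝ → V →L[ℝ] V →L[ℝ] ℝ := fun t => (A t).mkContinuous₂ CA (hAbdd t)
  set b : ℝ → X →L[ℝ] X →L[ℝ] ℝ := fun t => (B t).mkContinuous₂ CB (hBbdd t)
  set a' : ℝ → V →L[ℝ] V →L[ℝ] ℝ := fun t => (A' t).mkContinuous₂ CA' (hA'bdd t)
  set b' : ℝ → X →L[ℝ] X →L[ℝ] ℝ := fun t => (B' t).mkContinuous₂ CB' (hB'bdd t)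
  have ha' (t : ℝ) : BilinTendsto (fun h u v => (a (t + h) u v - a t u v) / h) (𝓝[≠] 0)
      (fun u v => a' t u v) := .of_taylor (hAder t)
  have hb' (t : ℝ) : BilinTendsto (fun h u v => (b (t + h) u v - b t u v) / h) (𝓝[≠] 0)
      (fun u v => b' t u v) := .of_taylor (hBder t)
  have ha'cont (t : ℝ) : BilinTendsto (fun h u v => a' (t + h) u v) (𝓝 0)
      (fun u v => a' t u v) := .of_unit_ball fun ε hε => by
    obtain ⟨η, hη, hH⟩ := hA'cont t ε hε
    filter_upwards [Metric.ball_mem_nhds (0 : ℝ) hη] with h hh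
    exact hH h (by simpa using hh)
  have hb'cont (t : ℝ) : BilinTendsto (fun h u v => b' (t + h) u v) (𝓝 0)
      (fun u v => b' t u v) := .of_unit_ball fun ε hε => by
    obtain ⟨η, hη, hH⟩ := hB'cont t ε hε
    filter_upwards [Metric.ball_mem_nhds (0 : ℝ) hη] with h hh
    exact hH h (by simpa using hh)
  have heig (t : ℝ) : ∃ u : V, ‖u‖ = 1 ∧ a t u = lam j t • (b t).bilinearComp ι ι u := by
    rw [hlamdef]
    exact exists_eigenvector_minMaxEig hι hcompact (a t) (b t) hδ (hAcoer t) (hBcoer t)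
      (hAsymm t) (hBsymm t) hj hL
  refine ⟨tendsto_rightDeriv_eigenvalue hι hcompact hδ hAcoer hBcoer hAsymm hBsymm ha' hb'
    ha'cont hb'cont heig (fun s => hdp j s hj) t, ?_⟩
  have hneg : Filter.Tendsto (fun h : ℝ => -h) (𝓝[<] 0) (𝓝[>] 0) := by
    simpa using tendsto_neg_nhdsLT (a := (0 : ℝ))
  have hneg' : Filter.Tendsto (fun h : ℝ => -h) (𝓝[>] 0) (𝓝[<] 0) := by
    simpa using tendsto_neg_nhdsGT (a := (0 : ℝ))
  have hneg0 : Filter.Tendsto (fun h : ℝ => -h) (𝓝 0) (𝓝 0) := by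
    simpa using (continuous_neg (G := ℝ)).tendsto 0
  have hne : Filter.Tendsto (fun h : ℝ => -h) (𝓝[≠] 0) (𝓝[≠] 0) :=
    tendsto_nhdsWithin_iff.mpr ⟨hneg0.mono_left nhdsWithin_le_nhds, by
      filter_upwards [self_mem_nhdsWithin] with h hh using neg_ne_zero.mpr hh⟩
  have ha'n (t : ℝ) : BilinTendsto (fun h u v => (a (-(t + h)) u v - a (-t) u v) / h) (𝓝[≠] 0)
      (fun u v => (-a' (-t)) u v) := by
    convert ((ha' (-t)).comp hne).neg using 4 with h u v
    · rw [neg_add, div_neg, neg_neg]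
    · rfl
  have ha'contn (t : ℝ) : BilinTendsto (fun h u v => (-a' (-(t + h))) u v) (𝓝 0)
      (fun u v => (-a' (-t)) u v) := by
    convert ((ha'cont (-t)).comp hneg0).neg using 4 with h u v
    · rw [neg_add]
      rfl
    · rfl
  have hb'n (t : ℝ) : BilinTendsto (fun h u v => (b (-(t + h)) u v - b (-t) u v) / h) (𝓝[≠] 0)
      (fun u v => (-b' (-t)) u v) := by
    convert ((hb' (-t)).comp hne).neg using 4 with h u v
    · rw [neg_add, div_neg, neg_neg]
    · rfl
  have hb'contn (t : ℝ) : BilinTendsto (fun h u v => (-b' (-(t + h))) u v) (𝓝 0)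
      (fun u v => (-b' (-t)) u v) := by
    convert ((hb'cont (-t)).comp hneg0).neg using 4 with h u v
    · rw [neg_add]
      rfl
    · rfl
  have hrefl := tendsto_rightDeriv_eigenvalue (a := fun s => a (-s)) (b := fun s => b (-s))
    (a' := fun s => -a' (-s)) (b' := fun s => -b' (-s)) (l := fun s => lam j (-s))
    (d := fun s => -dm j (-s)) hι hcompact hδ (fun s => hAcoer (-s)) (fun s => hBcoer (-s))
    (fun s => hAsymm (-s)) (fun s => hBsymm (-s)) ha'n hb'n
    ha'contn hb'contn (fun s => heig (-s))
    (fun s => by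
      refine (((hdm j (-s) hj).comp hneg').neg).congr fun h => ?_
      simp only [Function.comp, div_neg, neg_neg, neg_add]) (-t)
  refine ((hrefl.comp hneg).neg.congr fun h => ?_).trans (by simp)
  simp [add_comm]
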